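/- Let A be a two-sided skew brace such that (A,+) (equivalently (A,∘)) satisfies the maximum condition on subgroups. If (A,+) is nilpotent, then (A,∘) is nilpotent and A is a strongly nilpotent skew brace. -/

import Mathlib

/-- A skew (left) brace: a type with two group structures `(A,+)` and `(A,∘)`
(the latter written multiplicatively) sharing the same identity, satisfying the
left skew brace law `a ∘ (b + c) = a ∘ b − a + a ∘ c`. -/
class SkewBrace (A : Type*) extends AddGroup A, Group A where
  mul_add_eq : ∀ a b c : A, a * (b + c) = a * b - a + a * c

namespace SkewBrace

variable {A : Type*}

/-- A skew brace is two-sided if `(a + b) ∘ c = a ∘ c − c + b ∘ c`. -/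
def IsTwoSided (A : Type*) [SkewBrace A] : Prop :=
  ∀ a b c : A, (a + b) * c = a * c - c + b * c

/-- `a * b = −a + a∘b − b`. -/
def bstar [SkewBrace A] (a b : A) : A := -a + a * b - b

/-- the star operation of the opposite skew brace: `a *ₒₚ b = −b + a∘b − a`. -/
def bstarOp [SkewBrace A] (a b : A) : A := -b + a * b - a

/-- `X * Y`: the additive subgroup generated by all `x * y`, `x ∈ X`, `y ∈ Y`. -/
def starSet [SkewBrace A] (X Y : Set A) : AddSubgroup A :=
  AddSubgroup.closure {z | ∃ x ∈ X, ∃ y ∈ Y, z = bstar x y}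

/-- `A² = A * A`. -/
def sq (A : Type*) [SkewBrace A] : AddSubgroup A := starSet Set.univ Set.univ

/-- `A²ₒₚ`, the additive subgroup generated by all `a *ₒₚ b`. -/
def sqOp (A : Type*) [SkewBrace A] : AddSubgroup A :=
  AddSubgroup.closure {z | ∃ a b : A, z = bstarOp a b}

/-- A skew brace is weakly trivial if `A² ∩ A²ₒₚ = {0}`. -/
def IsWeaklyTrivial (A : Type*) [SkewBrace A] : Prop := sq A ⊓ sqOp A = ⊥

/-- An ideal of a skew brace: an additive subgroup, normal in `(A,+)` and in
`(A,∘)`, and invariant under all `λ_a : b ↦ −a + a∘b`. -/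
structure IsIdeal [SkewBrace A] (I : AddSubgroup A) : Prop where
  add_conj : ∀ a : A, ∀ x ∈ I, a + x - a ∈ I
  mul_conj : ∀ a : A, ∀ x ∈ I, a * x * a⁻¹ ∈ I
  lambda_mem : ∀ a : A, ∀ x ∈ I, -a + a * x ∈ I

/-- The left series `A¹ = A`, `Aⁿ⁺¹ = A * Aⁿ`; `leftSeries A n` is `Aⁿ⁺¹`. -/
def leftSeries (A : Type*) [SkewBrace A] : ℕ → AddSubgroup A
  | 0 => ⊤
  | n + 1 => starSet Set.univ (leftSeries A n : Set A)

/-- The right series `A⁽¹⁾ = A`, `A⁽ⁿ⁺¹⁾ = A⁽ⁿ⁾ * A`; `rightSeries A n` is `A⁽ⁿ⁺¹⁾`. -/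
def rightSeries (A : Type*) [SkewBrace A] : ℕ → AddSubgroup A
  | 0 => ⊤
  | n + 1 => starSet (rightSeries A n : Set A) Set.univ

/-- A skew brace is left nilpotent if its left series reaches `{0}`. -/
def IsLeftNilpotent (A : Type*) [SkewBrace A] : Prop := ∃ n, leftSeries A n = ⊥

/-- A skew brace is right nilpotent if its right series reaches `{0}`. -/
def IsRightNilpotent (A : Type*) [SkewBrace A] : Prop := ∃ n, rightSeries A n = ⊥

/-- The series `A⁽¹⁾ = A`, `A^[n+1]` generated by the union of `A^[i] * A^[n+1-i]`;
`strongSeries A n` is `A^[n+1]`. -/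
def strongSeries (A : Type*) [SkewBrace A] : ℕ → AddSubgroup A
  | 0 => ⊤
  | n + 1 => ⨆ i : Fin (n + 1),
      starSet (strongSeries A i.val : Set A) (strongSeries A (n - i.val) : Set A)
  decreasing_by
  · exact i.isLt
  · have := i.isLt; omega

/-- A skew brace is strongly nilpotent if the series `A^[n]` reaches `{0}`. -/
def IsStronglyNilpotent (A : Type*) [SkewBrace A] : Prop := ∃ n, strongSeries A n = ⊥

/-- The derived series of a skew brace: `A₁ = A`, `Aₙ₊₁ = Aₙ * Aₙ`;
`derivedSeriesBrace A n` is `Aₙ₊₁`. -/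
def derivedSeriesBrace (A : Type*) [SkewBrace A] : ℕ → AddSubgroup A
  | 0 => ⊤
  | n + 1 => starSet (derivedSeriesBrace A n : Set A) (derivedSeriesBrace A n : Set A)

/-- A skew brace is soluble if its derived series reaches `{0}`. -/
def IsSolubleBrace (A : Type*) [SkewBrace A] : Prop := ∃ n, derivedSeriesBrace A n = ⊥

end SkewBrace

attribute [local instance] LieRing.ofAssociativeRing
open Polynomial in
theorem jac_int : IsJacobsonRing ℤ := by
  rw [isJacobsonRing_iff_prime_eq]
  intro P hP
  by_cases h : P = ⊥
  · subst h
    rw [eq_bot_iff]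
    intro x hx
    rw [Ideal.mem_jacobson_bot] at hx
    have := hx x
    rw [Int.isUnit_iff] at this
    simp only [Ideal.mem_bot]
    rcases this with h | h <;> nlinarith
  · have := hP.isMaximal h
    exact Ideal.jacobson_eq_self_of_isMaximal

open Polynomial in
theorem nil_of_surj {M : Type*} [AddCommGroup M] [Module.Finite ℤ M] (s : Module.End ℤ M)
    (hs : ∀ g : ℤ[X], Function.Surjective (1 + aeval s (X * g) : Module.End ℤ M)) :
    IsNilpotent s := by
  have := jac_int
  have hX : (X : ℤ[X]) ∈ (RingHom.ker (aeval (R := ℤ) s)).radical := by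
    rw [Ideal.radical_eq_jacobson, Ideal.jacobson, Ideal.mem_sInf]
    · rintro m ⟨hIm, hm⟩
      by_contra hXm
      obtain ⟨g, y, hy, hgy⟩ := hm.exists_inv hXm
      have hy' : y = 1 + X * (-g) := by rw [← hgy]; ring
      have hle : (⊤ : Submodule ℤ[X] (Module.AEval' s)) ≤ m • ⊤ := by
        intro v _
        obtain ⟨w, hw⟩ := hs (-g) ((Module.AEval'.of s).symm v)
        have : v = y • (Module.AEval'.of s w) := by
          rw [← Module.AEval.of_aeval_smul, hy']
          apply (Module.AEval'.of s).symm.injective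
          rw [← hw]
          simp
        rw [this]
        exact Submodule.smul_mem_smul hy trivial
      obtain ⟨r, hr, hr0⟩ := Submodule.exists_sub_one_mem_and_smul_eq_zero_of_fg_of_le_smul m ⊤
        Module.Finite.fg_top hle
      have hrm : r ∈ m := by
        apply hIm
        rw [RingHom.mem_ker]
        ext w
        have := hr0 (Module.AEval'.of s w) trivial
        rw [← Module.AEval.of_aeval_smul] at this
        simpa using this
      apply hm.ne_top
      rw [Ideal.eq_top_iff_one]
      have := m.sub_mem hrm hr
      simpa using this
  obtain ⟨n, hn⟩ := hX
  refine ⟨n, ?_⟩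
  simpa [RingHom.mem_ker] using hn

theorem engel_vec {M : Type*} [AddCommGroup M] [IsNoetherian ℤ M] [Nontrivial M]
    (L : LieSubalgebra ℤ (Module.End ℤ M)) (hL : ∀ x ∈ L, IsNilpotent x) :
    ∃ m : M, m ≠ 0 ∧ ∀ x ∈ L, x m = 0 := by
  have : LieModule.IsNilpotent L M := by
    rw [LieModule.isNilpotent_iff_forall' (R := ℤ)]
    intro x
    exact hL x x.2
  obtain ⟨⟨m, hm⟩, hne⟩ := @exists_ne _ (LieModule.nontrivial_max_triv_of_isNilpotent ℤ L M) 0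
  refine ⟨m, fun h => hne (Subtype.ext h), fun x hx => ?_⟩
  exact (LieModule.mem_maxTrivSubmodule ℤ L M m).1 hm ⟨x, hx⟩
namespace SkewBrace

section basic
variable {A : Type*} [SkewBrace A]

theorem mul_zero' (a : A) : a * 0 = a := by
  have := mul_add_eq a 0 0
  rw [add_zero, sub_eq_add_neg, add_assoc] at this
  have h2 : -a + a * 0 = 0 := by simpa using this
  exact (neg_add_eq_zero.1 h2).symm

theorem zero_eq_one : (0 : A) = 1 := by
  have := mul_zero' (1 : A)
  simpa using this

theorem zero_mul' (a : A) : 0 * a = a := by rw [zero_eq_one, one_mul]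

theorem inv_mul' (a : A) : a⁻¹ * a = 0 := by rw [zero_eq_one]; simp
theorem mul_inv' (a : A) : a * a⁻¹ = 0 := by rw [zero_eq_one]; simp

/-- `λ_a`. -/
def lam (a : A) : A →+ A where
  toFun x := -a + a * x
  map_zero' := by rw [mul_zero']; simp
  map_add' x y := by rw [mul_add_eq]; simp [sub_eq_add_neg, add_assoc]

/-- `τ_a`. -/
def tau (h : IsTwoSided A) (a : A) : A →+ A where
  toFun x := x * a - a
  map_zero' := by rw [zero_mul']; simp
  map_add' x y := by rw [h]; simp [sub_eq_add_neg, add_assoc]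

theorem lam_apply (a x : A) : lam a x = -a + a * x := rfl
theorem tau_apply (h : IsTwoSided A) (a x : A) : tau h a x = x * a - a := rfl

theorem mul_eq_lam (a x : A) : a * x = a + lam a x := by simp [lam_apply]
theorem mul_eq_tau (h : IsTwoSided A) (a x : A) : x * a = tau h a x + a := by simp [tau_apply]

theorem lam_mul (a b x : A) : lam (a * b) x = lam a (lam b x) := by
  have : lam a (lam b x) = - lam a b + lam a (b * x) := by
    rw [lam_apply b x, map_add, map_neg]
  rw [this]
  simp [lam_apply, mul_assoc, add_assoc]

theorem tau_mul (h : IsTwoSided A) (a b x : A) : tau h (a * b) x = tau h b (tau h a x) := by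
  have : tau h b (tau h a x) = tau h b (x * a) - tau h b a := by
    rw [tau_apply h a x, map_sub]
  rw [this]
  simp [tau_apply, mul_assoc]

theorem lam_zero (x : A) : lam 0 x = x := by simp [lam_apply, zero_mul']
theorem tau_zero (h : IsTwoSided A) (x : A) : tau h 0 x = x := by simp [tau_apply, mul_zero']

theorem lam_inv_lam (a x : A) : lam a⁻¹ (lam a x) = x := by rw [← lam_mul, inv_mul', lam_zero]
theorem lam_lam_inv (a x : A) : lam a (lam a⁻¹ x) = x := by rw [← lam_mul, mul_inv', lam_zero]
theorem tau_tau_inv (h : IsTwoSided A) (a x : A) : tau h a (tau h a⁻¹ x) = x := by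
  rw [← tau_mul, inv_mul', tau_zero]
theorem tau_inv_tau (h : IsTwoSided A) (a x : A) : tau h a⁻¹ (tau h a x) = x := by
  rw [← tau_mul, mul_inv', tau_zero]

theorem lam_add_left (h : IsTwoSided A) (a b x : A) :
    lam (a + b) x = -b + (lam a x - x) + b + lam b x := by
  simp [lam_apply, h a b x, sub_eq_add_neg, add_assoc]

theorem tau_add_left (h : IsTwoSided A) (a b x : A) :
    tau h (a + b) x = tau h a x + (a + (-x + tau h b x) - a) := by
  simp [tau_apply, mul_add_eq, sub_eq_add_neg, add_assoc]

theorem mem_center {z : A} : z ∈ AddSubgroup.center A ↔ ∀ g, g + z = z + g :=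
  AddSubgroup.mem_center_iff

theorem lam_center (a : A) {z : A} (hz : z ∈ AddSubgroup.center A) :
    lam a z ∈ AddSubgroup.center A := by
  rw [mem_center] at *
  intro g
  have := congrArg (lam a) (hz (lam a⁻¹ g))
  simpa [lam_lam_inv] using this

theorem tau_center (h : IsTwoSided A) (a : A) {z : A} (hz : z ∈ AddSubgroup.center A) :
    tau h a z ∈ AddSubgroup.center A := by
  rw [mem_center] at *
  intro g
  have := congrArg (tau h a) (hz (tau h a⁻¹ g))
  simpa [tau_tau_inv] using this

theorem lam_tau_comm (h : IsTwoSided A) (a b : A) {z : A} (hz : z ∈ AddSubgroup.center A) :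
    lam a (tau h b z) = tau h b (lam a z) := by
  have h1 : a * z * b = a * (z * b) := mul_assoc _ _ _
  have hc1 := mem_center.1 (tau_center h b (lam_center a hz))
  have hc2 := mem_center.1 (lam_center a (tau_center h b hz))
  have e1 : a * z * b = a * b + tau h b (lam a z) := by
    rw [mul_eq_lam a z, h, mul_eq_tau h b (lam a z), ← hc1 b]
    simp [sub_eq_add_neg, add_assoc]
  have e2 : a * (z * b) = a * b + lam a (tau h b z) := by
    rw [mul_eq_tau h b z, mul_add_eq, mul_eq_lam a (tau h b z), hc2 a, hc2 (a * b)]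
    simp only [sub_eq_add_neg, add_assoc]
    simp [← add_assoc]
  rw [e1, e2] at h1
  exact (add_left_cancel h1).symm

end basic

section center
variable {A : Type*} [SkewBrace A] (h : IsTwoSided A)

/-- The center of the additive group. -/
abbrev Zc (A : Type*) [SkewBrace A] := AddSubgroup.center A

instance instCommZc (A : Type*) [SkewBrace A] : AddCommGroup (Zc A) :=
  { (Zc A).toAddGroup with
    add_comm := fun x y => Subtype.ext (mem_center.1 y.2 x) }

/-- `λ_a - 1` on the center. -/
def fL (a : A) : Module.End ℤ (Zc A) :=
  (((lam a).comp (Zc A).subtype).codRestrict (Zc A) (fun z => lam_center a z.2)).toIntLinearMap - 1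

/-- `τ_a - 1` on the center. -/
def fR (a : A) : Module.End ℤ (Zc A) :=
  (((tau h a).comp (Zc A).subtype).codRestrict (Zc A)
    (fun z => tau_center h a z.2)).toIntLinearMap - 1

theorem fL_apply (a : A) (z : Zc A) : ((fL a z : Zc A) : A) = lam a z - z := rfl
theorem fR_apply (a : A) (z : Zc A) : ((fR h a z : Zc A) : A) = tau h a z - z := rfl

theorem fL_add (h : IsTwoSided A) (a b : A) : fL (a + b) = fL a + fL b := by
  ext z
  have hc := mem_center.1 (fL a z).2
  simp only [LinearMap.add_apply, AddSubgroup.coe_add]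
  rw [fL_apply (a + b), lam_add_left h, ← fL_apply, hc (-b), fL_apply b]
  simp [add_assoc, sub_eq_add_neg]

theorem fR_add (a b : A) : fR h (a + b) = fR h a + fR h b := by
  ext z
  have hc := mem_center.1 (fR h b z).2
  have hz := mem_center.1 z.2
  have hz' := mem_center.1 ((Zc A).neg_mem z.2)
  simp only [LinearMap.add_apply, AddSubgroup.coe_add]
  have e : -(z : A) + tau h b z = fR h b z := by
    rw [fR_apply, sub_eq_add_neg, hz']
  rw [fR_apply h (a + b), tau_add_left h, e, hc a, add_sub_cancel_right, fR_apply h a,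
    sub_eq_add_neg, sub_eq_add_neg, add_assoc, add_assoc, hc]

theorem fL_mul (a b : A) : fL (a * b) = fL a * fL b + fL a + fL b := by
  ext z
  have e : ((fL a * fL b + fL a) z : Zc A) = fL a (fL b z + z) := by simp
  rw [LinearMap.add_apply, AddSubgroup.coe_add, e, fL_apply, fL_apply, fL_apply, lam_mul,
    AddSubgroup.coe_add, fL_apply]
  simp [sub_eq_add_neg, add_assoc]

theorem fR_mul (a b : A) : fR h (a * b) = fR h b * fR h a + fR h a + fR h b := by
  ext z
  have e : ((fR h b * fR h a + fR h b) z : Zc A) = fR h b (fR h a z + z) := by simp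
  rw [add_right_comm, LinearMap.add_apply, AddSubgroup.coe_add, e, fR_apply, fR_apply, fR_apply,
    tau_mul, AddSubgroup.coe_add, fR_apply]
  simp [sub_eq_add_neg, add_assoc]

theorem fL_fR_comm (a b : A) : Commute (fL a) (fR h b) := by
  have : Commute (fL a + 1) (fR h b + 1) := by
    ext z
    simpa [fL_apply, fR_apply, -map_add] using lam_tau_comm h a b z.2
  have h2 := (this.sub_left (Commute.one_left _)).sub_right (Commute.one_right _)
  simpa using h2

theorem surj_fL (a : A) : Function.Surjective (1 + fL a : Module.End ℤ (Zc A)) := by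
  intro z
  refine ⟨⟨lam a⁻¹ z, lam_center _ z.2⟩, ?_⟩
  ext
  have hc := mem_center.1 (lam_center a⁻¹ z.2)
  simp only [LinearMap.add_apply, AddSubgroup.coe_add, fL_apply, lam_lam_inv]
  change lam a⁻¹ z + _ = _
  rw [← hc]; simp

theorem surj_fR (a : A) : Function.Surjective (1 + fR h a : Module.End ℤ (Zc A)) := by
  intro z
  refine ⟨⟨tau h a⁻¹ z, tau_center h _ z.2⟩, ?_⟩
  ext
  have hc := mem_center.1 (tau_center h a⁻¹ z.2)
  simp only [LinearMap.add_apply, AddSubgroup.coe_add, fR_apply, tau_tau_inv]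
  change tau h a⁻¹ z + _ = _
  rw [← hc]; simp

open Polynomial in
theorem nil_of_range [Module.Finite ℤ (Zc A)] (f : A → Module.End ℤ (Zc A))
    (S : AddSubgroup (Module.End ℤ (Zc A)))
    (hS : ∀ s ∈ S, ∀ t ∈ S, s * t ∈ S) (hf : ∀ s ∈ S, ∃ a, s = f a)
    (hsurj : ∀ a, Function.Surjective (1 + f a : Module.End ℤ (Zc A)))
    (s : Module.End ℤ (Zc A)) (hs : s ∈ S) : IsNilpotent s := by
  have key : ∀ g : ℤ[X], aeval s (X * g) ∈ S := by
    intro g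
    induction g using Polynomial.induction_on' with
    | add p q hp hq => rw [mul_add, map_add]; exact S.add_mem hp hq
    | monomial n c =>
      have hp : ∀ n : ℕ, s ^ (n + 1) ∈ S := by
        intro n
        induction n with
        | zero => simpa using hs
        | succ n ih => rw [pow_succ]; exact hS _ ih _ hs
      have : aeval s (X * monomial n c) = c • s ^ (n + 1) := by
        rw [X_mul_monomial, aeval_monomial, Algebra.smul_def]
      rw [this]
      exact S.zsmul_mem (hp n) c
  apply nil_of_surj
  intro g
  obtain ⟨a, ha⟩ := hf _ (key g)
  rw [ha]
  exact hsurj a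

/-- additive range of `fL`. -/
def SL : AddSubgroup (Module.End ℤ (Zc A)) := (AddMonoidHom.mk' (fL (A := A)) (fL_add h)).range
/-- additive range of `fR`. -/
def SR : AddSubgroup (Module.End ℤ (Zc A)) := (AddMonoidHom.mk' (fR h) (fR_add h)).range

theorem mem_SL {s} : s ∈ SL h ↔ ∃ a, fL a = s := Iff.rfl
theorem mem_SR {s} : s ∈ SR h ↔ ∃ a, fR h a = s := Iff.rfl

theorem SL_mul : ∀ s ∈ SL h, ∀ t ∈ SL h, s * t ∈ SL h := by
  rintro _ ⟨a, rfl⟩ _ ⟨b, rfl⟩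
  have : fL a * fL b = fL (a * b) - fL b - fL a := by rw [fL_mul]; abel
  change fL a * fL b ∈ _
  rw [this]
  exact sub_mem (sub_mem ⟨_, rfl⟩ ⟨_, rfl⟩) ⟨_, rfl⟩

theorem SR_mul : ∀ s ∈ SR h, ∀ t ∈ SR h, s * t ∈ SR h := by
  rintro _ ⟨a, rfl⟩ _ ⟨b, rfl⟩
  have : fR h a * fR h b = fR h (b * a) - fR h b - fR h a := by rw [fR_mul]; abel
  change fR h a * fR h b ∈ _
  rw [this]
  exact sub_mem (sub_mem ⟨_, rfl⟩ ⟨_, rfl⟩) ⟨_, rfl⟩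

theorem SL_SR_comm {s t} (hs : s ∈ SL h) (ht : t ∈ SR h) : Commute s t := by
  obtain ⟨a, rfl⟩ := hs
  obtain ⟨b, rfl⟩ := ht
  exact fL_fR_comm h a b

theorem exists_ann_center [IsNoetherian ℤ (Zc A)] [Nontrivial (Zc A)] :
    ∃ z : A, z ≠ 0 ∧ (∀ a, a + z = z + a) ∧ (∀ a, lam a z = z) ∧ (∀ a, tau h a z = z) := by
  let L : LieSubalgebra ℤ (Module.End ℤ (Zc A)) :=
    { AddSubgroup.toIntSubmodule (SL h ⊔ SR h) with
      lie_mem' := by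
        intro x y hx hy
        change x ∈ SL h ⊔ SR h at hx
        change y ∈ SL h ⊔ SR h at hy
        change ⁅x, y⁆ ∈ SL h ⊔ SR h
        obtain ⟨a, ha, b, hb, rfl⟩ := AddSubgroup.mem_sup.1 hx
        obtain ⟨c, hc, d, hd, rfl⟩ := AddSubgroup.mem_sup.1 hy
        have e : ⁅a + b, c + d⁆ = (a * c - c * a) + (b * d - d * b) := by
          have h1 := (SL_SR_comm h ha hd).eq
          have h2 := (SL_SR_comm h hc hb).eq
          rw [LieRing.of_associative_ring_bracket]
          simp only [add_mul, mul_add]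
          rw [h1, h2]; abel
        rw [e]
        exact AddSubgroup.add_mem_sup (sub_mem (SL_mul h _ ha _ hc) (SL_mul h _ hc _ ha))
          (sub_mem (SR_mul h _ hb _ hd) (SR_mul h _ hd _ hb)) }
  have hmemL : ∀ x, x ∈ L ↔ x ∈ SL h ⊔ SR h := fun x => Iff.rfl
  obtain ⟨z, hz, hz0⟩ := engel_vec L (by
    intro x hx
    obtain ⟨a, ha, b, hb, rfl⟩ := AddSubgroup.mem_sup.1 ((hmemL x).1 hx)
    apply (SL_SR_comm h ha hb).isNilpotent_add
    · exact nil_of_range fL (SL h) (SL_mul h) (fun s ⟨a, ha⟩ => ⟨a, ha.symm⟩) surj_fL a ha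
    · exact nil_of_range (fR h) (SR h) (SR_mul h) (fun s ⟨a, ha⟩ => ⟨a, ha.symm⟩) (surj_fR h) b hb)
  refine ⟨z, fun h0 => hz (Subtype.ext h0), mem_center.1 z.2, fun a => ?_, fun a => ?_⟩
  · have := hz0 (fL a) ((hmemL _).2 (AddSubgroup.mem_sup_left ⟨a, rfl⟩))
    have := congrArg (Subtype.val) this
    rw [fL_apply] at this
    exact sub_eq_zero.1 this
  · have := hz0 (fR h a) ((hmemL _).2 (AddSubgroup.mem_sup_right ⟨a, rfl⟩))
    have := congrArg (Subtype.val) this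
    rw [fR_apply] at this
    exact sub_eq_zero.1 this

end center
end SkewBrace
namespace SkewBrace
section quot
variable {A : Type*} [SkewBrace A] (h : IsTwoSided A)

/-- Ideals in the sense used here. -/
structure Idl (I : AddSubgroup A) : Prop where
  normal : I.Normal
  lam_mem : ∀ a, ∀ x ∈ I, lam a x ∈ I
  tau_mem : ∀ a, ∀ x ∈ I, tau h a x ∈ I

theorem lam_neg_add (a b c : A) : lam a (-b + c) = -(a * b) + a * c := by
  rw [map_add, map_neg]; simp [lam_apply, add_assoc]

theorem tau_sub (a b c : A) : tau h a (b - c) = b * a - c * a := by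
  rw [map_sub]; simp [tau_apply]

variable {h}

theorem Idl.mul_congr {I : AddSubgroup A} (hI : Idl h I) {a a' b b' : A}
    (ha : -a + a' ∈ I) (hb : -b + b' ∈ I) : -(a * b) + a' * b' ∈ I := by
  have h1 := hI.lam_mem a _ hb
  rw [lam_neg_add] at h1
  have h2 := hI.tau_mem b' (a' - a) (by rw [sub_eq_add_neg]; exact hI.normal.mem_comm ha)
  rw [tau_sub, sub_eq_add_neg] at h2
  have h3 := I.add_mem h1 (hI.normal.mem_comm h2)
  simpa [add_assoc] using h3

theorem Idl.inv_congr {I : AddSubgroup A} (hI : Idl h I) {a a' : A}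
    (ha : -a + a' ∈ I) : -(a⁻¹) + a'⁻¹ ∈ I := by
  have h1 := hI.mul_congr (a := a⁻¹) (a' := a⁻¹) (by simp) ha
  rw [inv_mul'] at h1
  have h2 := hI.mul_congr h1 (b := a'⁻¹) (b' := a'⁻¹) (by simp)
  rw [zero_mul'] at h2
  have h3 := I.neg_mem h2
  simpa using h3

/-- The quotient skew brace. -/
@[reducible] def quotBrace {I : AddSubgroup A} (hI : Idl h I) : SkewBrace (A ⧸ I) :=
  haveI := hI.normal
  letI : Mul (A ⧸ I) := ⟨Quotient.map₂ (· * ·) (by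
    intro a a' ha b b' hb
    exact QuotientAddGroup.leftRel_apply.2 (hI.mul_congr (QuotientAddGroup.leftRel_apply.1 ha)
      (QuotientAddGroup.leftRel_apply.1 hb)))⟩
  letI : Inv (A ⧸ I) := ⟨Quotient.map (·⁻¹) (by
    intro a a' ha
    exact QuotientAddGroup.leftRel_apply.2 (hI.inv_congr (QuotientAddGroup.leftRel_apply.1 ha)))⟩
  letI : One (A ⧸ I) := ⟨((1 : A) : A ⧸ I)⟩
  { QuotientAddGroup.Quotient.addGroup I,
    Group.ofLeftAxioms (G := A ⧸ I)
      (by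
        rintro ⟨a⟩ ⟨b⟩ ⟨c⟩
        exact congrArg (QuotientAddGroup.mk (s := I)) (mul_assoc a b c))
      (by
        rintro ⟨a⟩
        exact congrArg (QuotientAddGroup.mk (s := I)) (one_mul a))
      (by
        rintro ⟨a⟩
        exact congrArg (QuotientAddGroup.mk (s := I)) (inv_mul_cancel a)) with
    mul_add_eq := by
      rintro ⟨a⟩ ⟨b⟩ ⟨c⟩
      exact congrArg (QuotientAddGroup.mk (s := I)) (mul_add_eq a b c) }

theorem quot_twoSided {I : AddSubgroup A} (hI : Idl h I) :
    @IsTwoSided (A ⧸ I) (quotBrace hI) := by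
  rintro ⟨a⟩ ⟨b⟩ ⟨c⟩
  exact congrArg (QuotientAddGroup.mk (s := I)) (h a b c)

theorem exists_ann (h : IsTwoSided A) [WellFoundedGT (AddSubgroup A)] [Nontrivial A]
    (hnil : Group.IsNilpotent (Multiplicative A)) :
    ∃ z : A, z ≠ 0 ∧ (∀ a, a + z = z + a) ∧ (∀ a, lam a z = z) ∧ (∀ a, tau h a z = z) := by
  have : IsNoetherian ℤ (Zc A) := by
    rw [isNoetherian_iff']
    refine StrictMono.wellFoundedGT
      (f := fun N : Submodule ℤ (Zc A) => N.toAddSubgroup.map (Zc A).subtype) ?_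
    apply Monotone.strictMono_of_injective
    · intro M N hMN
      exact AddSubgroup.map_mono hMN
    · intro M N hMN
      have := AddSubgroup.map_injective (Zc A).subtype_injective hMN
      exact Submodule.toAddSubgroup_injective this
  have : Nontrivial (Zc A) := by
    have h1 := Group.IsNilpotent.center_ne_bot (G := Multiplicative A)
    rw [Subgroup.ne_bot_iff_exists_ne_one] at h1
    obtain ⟨⟨z, hz⟩, hne⟩ := h1
    refine ⟨⟨⟨z.toAdd, ?_⟩, 0, ?_⟩⟩
    · rw [mem_center]
      intro g
      exact Subgroup.mem_center_iff.1 hz (Multiplicative.ofAdd g)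
    · intro h0
      apply hne
      apply Subtype.ext
      exact congrArg (fun x : Zc A => (x : A)) h0
  exact exists_ann_center h

/-- Hypercentral ideals. -/
inductive Good (h : IsTwoSided A) : AddSubgroup A → Prop
  | bot : Good h ⊥
  | step (I J : AddSubgroup A) : Good h I → Idl h I →
      (∀ x ∈ J, ∀ a, -(a + x) + (x + a) ∈ I ∧ -x + lam a x ∈ I ∧ -x + tau h a x ∈ I) → Good h J

theorem idl_bot : Idl h (⊥ : AddSubgroup A) where
  normal := inferInstance
  lam_mem := by intro a x hx; rw [AddSubgroup.mem_bot] at *; rw [hx, map_zero]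
  tau_mem := by intro a x hx; rw [AddSubgroup.mem_bot] at *; rw [hx, map_zero]

theorem exists_bigger [WellFoundedGT (AddSubgroup A)]
    (hnil : Group.IsNilpotent (Multiplicative A)) {I : AddSubgroup A} (hI : Idl h I)
    (hne : I ≠ ⊤) : ∃ J, I < J ∧ Idl h J ∧
      (∀ x ∈ J, ∀ a, -(a + x) + (x + a) ∈ I ∧ -x + lam a x ∈ I ∧ -x + tau h a x ∈ I) := by
  have hn := hI.normal
  let _ := quotBrace hI
  have h2 := quot_twoSided hI
  let π : A →+ A ⧸ I := QuotientAddGroup.mk' I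
  have hπ : Function.Surjective π := QuotientAddGroup.mk'_surjective I
  have hker : ∀ x y : A, π x = π y ↔ -x + y ∈ I := fun x y => QuotientAddGroup.eq
  have : WellFoundedGT (AddSubgroup (A ⧸ I)) := by
    refine StrictMono.wellFoundedGT (f := fun N => AddSubgroup.comap π N) ?_
    apply Monotone.strictMono_of_injective
    · intro M N hMN
      exact AddSubgroup.comap_mono hMN
    · exact AddSubgroup.comap_injective hπ
  have : Nontrivial (A ⧸ I) := by
    obtain ⟨x, -, hx⟩ := SetLike.exists_of_lt (lt_top_iff_ne_top.2 hne)
    refine ⟨⟨π x, π 0, fun hh => hx ?_⟩⟩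
    simpa using (hker _ _).1 hh
  have hnil' : Group.IsNilpotent (Multiplicative (A ⧸ I)) :=
    Group.nilpotent_of_surjective (AddMonoidHom.toMultiplicative π) hπ
  obtain ⟨z, hz0, hz1, hz2, hz3⟩ := exists_ann h2 hnil'
  obtain ⟨x, rfl⟩ := hπ z
  have hlam : ∀ a y, π (lam a y) = lam (π a) (π y) := fun a y => rfl
  have htau : ∀ a y, π (tau h a y) = tau h2 (π a) (π y) := fun a y => rfl
  -- the annihilator
  let Ann : AddSubgroup (A ⧸ I) :=
    { carrier := {z | (∀ a, a + z = z + a) ∧ (∀ a, lam a z = z) ∧ (∀ a, tau h2 a z = z)}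
      zero_mem' := by refine ⟨?_, ?_, ?_⟩ <;> intro a <;> simp
      add_mem' := by
        rintro u v ⟨hu1, hu2, hu3⟩ ⟨hv1, hv2, hv3⟩
        refine ⟨fun a => ?_, fun a => ?_, fun a => ?_⟩
        · rw [← add_assoc, hu1, add_assoc, hv1, add_assoc]
        · rw [map_add, hu2, hv2]
        · rw [map_add, hu3, hv3]
      neg_mem' := by
        rintro u ⟨hu1, hu2, hu3⟩
        refine ⟨fun a => ?_, fun a => ?_, fun a => ?_⟩
        · have := hu1 (-a)
          have := congrArg Neg.neg this
          simpa using this.symm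
        · rw [map_neg, hu2]
        · rw [map_neg, hu3] }
  have hAnn : ∀ y, y ∈ AddSubgroup.comap π Ann ↔ (∀ a, a + π y = π y + a) ∧
    (∀ a, lam a (π y) = π y) ∧ (∀ a, tau h2 a (π y) = π y) := fun y => Iff.rfl
  refine ⟨AddSubgroup.comap π Ann, ?_, ⟨⟨?_⟩, ?_, ?_⟩, ?_⟩
  · rw [SetLike.lt_iff_le_and_exists]
    refine ⟨fun y hy => ?_, x, ⟨hz1, hz2, hz3⟩, fun hx => hz0 ?_⟩
    · have : π y = 0 := by
        rw [← map_zero π, eq_comm, hker]; simpa using hy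
      rw [AddSubgroup.mem_comap, this]
      exact Ann.zero_mem
    · rw [← map_zero π, eq_comm, hker]; simpa using hx
  · intro y hy g
    have : π (g + y + -g) = π y := by
      rw [map_add, map_add, hy.1, map_neg, add_neg_cancel_right]
    rw [AddSubgroup.mem_comap, this]
    exact hy
  · intro a y hy
    rw [AddSubgroup.mem_comap, hlam, hy.2.1]
    exact hy
  · intro a y hy
    rw [AddSubgroup.mem_comap, htau, hy.2.2]
    exact hy
  · intro y hy a
    rw [hAnn] at hy
    refine ⟨(hker _ _).1 ?_, (hker _ _).1 ?_, (hker _ _).1 ?_⟩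
    · rw [map_add, map_add, hy.1]
    · rw [hlam, hy.2.1]
    · rw [htau, hy.2.2]

theorem good_top (h : IsTwoSided A) [WellFoundedGT (AddSubgroup A)]
    (hnil : Group.IsNilpotent (Multiplicative A)) : Good h (⊤ : AddSubgroup A) := by
  obtain ⟨I, ⟨hg, hI⟩, hmax⟩ := (wellFounded_gt (α := AddSubgroup A)).has_min
    {I | Good h I ∧ Idl h I} ⟨⊥, Good.bot, idl_bot⟩
  by_cases hne : I = ⊤
  · rwa [← hne]
  · obtain ⟨J, hlt, hJ, hs⟩ := exists_bigger hnil hI hne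
    exact absurd hlt (hmax J ⟨Good.step I J hg hI hs, hJ⟩)

theorem strong_of_good {J : AddSubgroup A} (hJ : Good h J) :
    ∀ m0, (∀ m ≥ m0, strongSeries A m ≤ J) → ∃ m1, ∀ m ≥ m1, strongSeries A m ≤ ⊥ := by
  induction hJ with
  | bot => exact fun m0 hm => ⟨m0, hm⟩
  | step I J hgI hI hs ih =>
    intro m0 hm
    apply ih (2 * m0 + 1)
    intro m hm'
    obtain ⟨k, rfl⟩ : ∃ k, m = k + 1 := ⟨m - 1, by omega⟩
    rw [strongSeries]
    apply iSup_le
    intro i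
    rw [starSet, AddSubgroup.closure_le]
    rintro _ ⟨x, hx, y, hy, rfl⟩
    have hi := i.isLt
    by_cases hc : m0 ≤ i.val
    · have hxJ := hm _ hc hx
      have := (hs x hxJ y).2.2
      have e : bstar x y = -x + tau h y x := by simp [bstar, tau_apply, sub_eq_add_neg, add_assoc]
      rw [e]; exact this
    · have hyJ := hm (k - i.val) (by omega) hy
      have := (hs y hyJ x).2.1
      have e : bstar x y = lam x y + -y := by simp [bstar, lam_apply, sub_eq_add_neg]
      rw [e]; exact hI.normal.mem_comm this

theorem mul_nil_of_good {J : AddSubgroup A} (hJ : Good h J) :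
    ∀ n, (∀ x ∈ (⊤ : Subgroup A).lowerCentralSeries n, x ∈ J) →
      ∃ n, (⊤ : Subgroup A).lowerCentralSeries n = ⊥ := by
  induction hJ with
  | bot =>
    intro n hn
    refine ⟨n, (Subgroup.eq_bot_iff_forall _).2 fun x hx => ?_⟩
    rw [← zero_eq_one]
    exact AddSubgroup.mem_bot.1 (hn x hx)
  | step I J hgI hI hs ih =>
    intro n hn
    apply ih (n + 1)
    let K : Subgroup A :=
      { carrier := I
        one_mem' := by rw [← zero_eq_one]; exact I.zero_mem
        mul_mem' := by
          intro a b ha hb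
          have := hI.mul_congr (a := 0) (b := 0) (a' := a) (b' := b) (by simpa using ha)
            (by simpa using hb)
          simpa [mul_zero'] using this
        inv_mem' := by
          intro a ha
          have := hI.inv_congr (a := 0) (a' := a) (by simpa using ha)
          rw [zero_eq_one, inv_one, ← zero_eq_one] at this
          simpa using this }
    have : (⊤ : Subgroup A).lowerCentralSeries (n + 1) ≤ K := by
      rw [Subgroup.lowerCentralSeries_succ, Subgroup.commutator_le]
      intro x hx a _
      obtain ⟨h1, h2, h3⟩ := hs x (hn x hx) a
      change x * a * x⁻¹ * a⁻¹ ∈ I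
      have hn := hI.normal
      -- `a * x ≡ a + x ≡ x + a ≡ x * a`
      have e1 : -(a + x) + a * x ∈ I := by
        have : -(a + x) + a * x = -x + lam a x := by simp [lam_apply, add_assoc]
        rw [this]; exact h2
      have e2 : -(x * a) + (x + a) ∈ I := by
        have : -(x * a) + (x + a) = -a + -(-x + tau h a x) + - -a := by
          simp [tau_apply, sub_eq_add_neg, add_assoc]
        rw [this]; exact hn.conj_mem _ (I.neg_mem h3) (-a)
      have e3 : -(x * a) + a * x ∈ I := by
        have := I.add_mem (I.add_mem e2 (I.neg_mem h1)) e1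
        simpa [add_assoc] using this
      have e4 := hI.mul_congr (b := (a * x)⁻¹) (b' := (a * x)⁻¹) e3 (by simp)
      rw [mul_inv'] at e4
      have e5 := I.neg_mem e4
      simpa [mul_assoc] using e5
    exact fun x hx => this hx

end quot
end SkewBrace

open SkewBrace in
/-- Let `A` be a two-sided skew brace satisfying the maximum condition on subgroups.
If `(A,+)` is nilpotent then `(A,∘)` is nilpotent and `A` is strongly nilpotent. -/
theorem nilpotent_of_max_condition (A : Type*) [SkewBrace A] (h : IsTwoSided A)
    (hmax : ¬ ∃ f : ℕ → AddSubgroup A, StrictMono f)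
    (hnil : Group.IsNilpotent (Multiplicative A)) :
    Group.IsNilpotent A ∧ IsStronglyNilpotent A := by
  have : WellFoundedGT (AddSubgroup A) := by
    refine ⟨RelEmbedding.wellFounded_iff_isEmpty.2 ⟨fun f => hmax ⟨f, ?_⟩⟩⟩
    exact strictMono_nat_of_lt_succ fun n => f.map_rel_iff.2 (Nat.lt_succ_self n)
  have hg := good_top h hnil
  constructor
  · rw [Subgroup.nilpotent_iff_lowerCentralSeries]
    exact mul_nil_of_good hg 0 fun x _ => trivial
  · obtain ⟨m, hm⟩ := strong_of_good hg 0 fun m _ => le_top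
    exact ⟨m, le_bot_iff.1 (hm m le_rfl)⟩
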